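/- arXiv:1706.08557 — 2 statements merged into one kernel-verified Lean document; each statement's English description precedes it below -/
import Mathlib

section
/- Let α1, α2 > 0, λ ≥ 0, set α⁺ = α1 + α2, and let r ∈ ℕ. Then Σ_{j=0}^{∞} (e^{−λ/2}(λ/2)^j/j!) · (α1+j)_r/(α⁺+j)_r = [(α1)_r/(α⁺)_r] · e^{−λ/2} · Σ_{i=0}^{r} [binomial(r,i) · (α⁺)_i · (λ/2)^i / ((α1)_i · (α⁺+r)_i)] · _1F_1(α⁺+i; α⁺+r+i; λ/2). -/
open scoped Nat

/-- Ascending factorial (Pochhammer symbol) `(a)_n = a(a+1)⋯(a+n-1)` for a real `a`. -/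
noncomputable def asc (a : ℝ) (n : ℕ) : ℝ := Polynomial.eval a (ascPochhammer ℝ n)

/-- Kummer's confluent hypergeometric function `₁F₁(a;b;z)`. -/
noncomputable def F11 (a b z : ℝ) : ℝ := ∑' k : ℕ, asc a k / asc b k * z ^ k / (k ! : ℝ)

theorem asc_zero (x : ℝ) : asc x 0 = 1 := by simp [asc]

theorem asc_add (x : ℝ) (m n : ℕ) : asc x (m + n) = asc x m * asc (x + m) n := by
  simp [asc, ← ascPochhammer_mul]

theorem asc_one (x : ℝ) : asc x 1 = x := by simp [asc]

theorem asc_succ_left (x : ℝ) (n : ℕ) : asc x (n + 1) = x * asc (x + 1) n := by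
  rw [add_comm, asc_add, asc_one, Nat.cast_one]

theorem asc_pos {x : ℝ} (hx : 0 < x) (n : ℕ) : 0 < asc x n := ascPochhammer_pos n x hx

theorem asc_le_asc {x y : ℝ} (hx : 0 < x) (hxy : x ≤ y) (n : ℕ) : asc x n ≤ asc y n := by
  induction n with
  | zero => simp [asc_zero]
  | succ n ih =>
    rw [asc_add, asc_add, asc_one, asc_one]
    have := asc_pos (hx.trans_le hxy) n
    gcongr

/-- The series defining `F11 a b z` converges when `0 < a ≤ b`. -/
theorem summable_F11 {a b : ℝ} (ha : 0 < a) (hab : a ≤ b) (z : ℝ) :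
    Summable fun k : ℕ => asc a k / asc b k * z ^ k / (k ! : ℝ) := by
  refine .of_norm_bounded (Real.summable_pow_div_factorial |z|) fun k => ?_
  have hb := asc_pos (ha.trans_le hab) k
  have hk := asc_pos ha k
  rw [norm_div, norm_mul, norm_pow, Real.norm_of_nonneg (by positivity : 0 ≤ asc a k / asc b k),
    Real.norm_of_nonneg (by positivity : (0 : ℝ) ≤ (k ! : ℝ)), Real.norm_eq_abs]
  gcongr
  exact mul_le_of_le_one_left (by positivity) ((div_le_one hb).2 (asc_le_asc ha hab k))

/-- A Chu–Vandermonde expansion of the ascending factorial of `a + j`. -/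
theorem asc_add_natCast (a : ℝ) (j r : ℕ) :
    asc (a + j) r = ∑ i ∈ Finset.range (r + 1),
      (r.choose i : ℝ) * ((j.descFactorial i : ℝ) * asc (a + i) (r - i)) := by
  induction r generalizing a with
  | zero => simp [asc_zero]
  | succ r ih =>
    rw [Finset.sum_choose_succ_mul (fun i k => (j.descFactorial i : ℝ) * asc (a + i) k) r,
      ← Finset.sum_add_distrib, asc_succ_left, add_right_comm, ih, Finset.mul_sum]
    refine Finset.sum_congr rfl fun i hi => ?_
    have hir : i ≤ r := Nat.lt_succ_iff.1 (Finset.mem_range.1 hi)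
    have hdesc : (j.descFactorial (i + 1) : ℝ) = ((j : ℝ) - i) * j.descFactorial i := by
      rcases le_or_gt i j with h | h
      · rw [Nat.descFactorial_succ]; push_cast [h]; ring
      · simp [Nat.descFactorial_of_lt h]
    rw [Nat.sub_add_comm hir, asc_succ_left, hdesc, add_right_comm a (i : ℝ) 1,
      show a + ((i + 1 : ℕ) : ℝ) = a + 1 + i by push_cast; ring]
    ring

/-- The power series of `z ^ i * F11 (b + i) (b + r + i) z`, re-indexed by the power of `z`. -/
theorem hasSum_pow_mul_F11 {b : ℝ} (hb : 0 < b) (z : ℝ) (r i : ℕ) :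
    HasSum (fun j : ℕ => asc b j / asc (b + r) j * z ^ j / (j ! : ℝ) * j.descFactorial i)
      (asc b i * z ^ i / asc (b + r) i * F11 (b + i) (b + r + i) z) := by
  have hbr : 0 < b + r := by positivity
  rw [← (add_left_injective i).hasSum_iff]
  · refine (congrArg (HasSum · _) (funext fun k => ?_)).mpr <|
      (summable_F11 (by positivity : 0 < b + i)
        (by linarith [(Nat.cast_nonneg r : (0 : ℝ) ≤ r)] : b + i ≤ b + r + i) z).hasSum.mul_left
        (asc b i * z ^ i / asc (b + r) i)
    have hfac : ((k + i)! : ℝ) = k ! * (k + i).descFactorial i := by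
      rw [← Nat.factorial_mul_descFactorial (Nat.le_add_left i k), Nat.add_sub_cancel]
      push_cast; rfl
    have hd : ((k + i).descFactorial i : ℝ) ≠ 0 :=
      right_ne_zero_of_mul (hfac ▸ Nat.cast_ne_zero.2 (k + i).factorial_ne_zero)
    have h₁ := (asc_pos hbr i).ne'
    have h₂ := (asc_pos (by positivity : 0 < b + r + i) k).ne'
    simp only [Function.comp_apply]
    rw [hfac, add_comm k i, asc_add, asc_add, pow_add]
    rw [add_comm k i] at hd
    field_simp
  · intro j hj
    have hji : j < i := by
      by_contra! h
      exact hj ⟨j - i, Nat.sub_add_cancel h⟩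
    simp [Nat.descFactorial_of_lt hji]

/-- Expansion of the ratio `(a + j)_r / (b + j)_r` of ascending factorials. -/
theorem asc_add_div_asc_add {a b : ℝ} (ha : 0 < a) (hb : 0 < b) (j r : ℕ) :
    asc (a + j) r / asc (b + j) r = asc a r / asc b r * ∑ i ∈ Finset.range (r + 1),
      (r.choose i : ℝ) / asc a i * (asc b j / asc (b + r) j * j.descFactorial i) := by
  rw [asc_add_natCast, Finset.sum_div, Finset.mul_sum]
  refine Finset.sum_congr rfl fun i hi => ?_
  have hir : i ≤ r := Nat.lt_succ_iff.1 (Finset.mem_range.1 hi)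
  have hsplit : asc a r = asc a i * asc (a + i) (r - i) := by
    rw [← asc_add, Nat.add_sub_cancel' hir]
  have hswap : asc b r * asc (b + r) j = asc b j * asc (b + j) r := by
    rw [← asc_add, ← asc_add, add_comm]
  have h₁ := (asc_pos ha i).ne'
  have h₂ := (asc_pos hb j).ne'
  have h₃ := (asc_pos hb r).ne'
  have h₄ := (asc_pos (by positivity : 0 < b + j) r).ne'
  have h₅ := (asc_pos (by positivity : 0 < b + r) j).ne'
  rw [hsplit]
  field_simp
  linear_combination (r.choose i : ℝ) * j.descFactorial i * asc (a + i) (r - i) * hswap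

/-- Moments about zero of the type 1 non-central beta distribution:
the `r`-th moment (the Poisson-weighted mixture of beta moments) equals
`[(α1)_r/(α⁺)_r] e^{−λ/2} Σ_{i=0}^{r} [C(r,i)(α⁺)_i(λ/2)^i/((α1)_i(α⁺+r)_i)]
·₁F₁(α⁺+i; α⁺+r+i; λ/2)`. -/
theorem ncBeta1_moment (α1 α2 lam : ℝ)
    (hα1 : 0 < α1) (hα2 : 0 < α2) (hlam : 0 ≤ lam) (r : ℕ) :
    (∑' j : ℕ, (Real.exp (-(lam / 2)) * (lam / 2) ^ j / (j ! : ℝ)) *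
        (asc (α1 + j) r / asc (α1 + α2 + j) r)) =
      (asc α1 r / asc (α1 + α2) r) * Real.exp (-(lam / 2)) *
        ∑ i ∈ Finset.range (r + 1),
          ((r.choose i : ℝ) * asc (α1 + α2) i * (lam / 2) ^ i /
              (asc α1 i * asc (α1 + α2 + r) i)) *
            F11 (α1 + α2 + i) (α1 + α2 + r + i) (lam / 2) := by
  have hb : 0 < α1 + α2 := add_pos hα1 hα2
  have key := (hasSum_sum fun i (_ : i ∈ Finset.range (r + 1)) =>
    (hasSum_pow_mul_F11 hb (lam / 2) r i).mul_left ((r.choose i : ℝ) / asc α1 i)).mul_left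
      (asc α1 r / asc (α1 + α2) r * Real.exp (-(lam / 2)))
  convert key.tsum_eq using 1
  · refine tsum_congr fun j => ?_
    rw [asc_add_div_asc_add hα1 hb]
    simp only [Finset.mul_sum]
    refine Finset.sum_congr rfl fun i _ => ?_
    ring
  · congr 1
    refine Finset.sum_congr rfl fun i _ => ?_
    rw [← div_div]
    ring
end

section
/- Let α1, α2 > 0 and λ1, λ2 ≥ 0 with λ⁺ = λ1 + λ2 > 0, and set α⁺ = α1 + α2. Then the mean M = Σ_{j=0}^{∞} Σ_{k=0}^{∞} (e^{−λ1/2}(λ1/2)^j/j!)·(e^{−λ2/2}(λ2/2)^k/k!)·(α1+j)/(α⁺+j+k) of the doubly non-central beta distribution with parameters (α1, α2, λ1, λ2) satisfies M = (α1/α⁺)·[e^{−λ⁺/2}·_1F_1(α⁺; α⁺+1; λ⁺/2)] + (λ1/λ⁺)·[1 − e^{−λ⁺/2}·_1F_1(α⁺; α⁺+1; λ⁺/2)]. -/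
open scoped Nat

lemma asc_div_asc_add_one {a : ℝ} (ha : 0 < a) (n : ℕ) :
    asc a n / asc (a + 1) n = a / (a + n) := by
  have hpos : 0 < asc (a + 1) n := ascPochhammer_pos n (a + 1) (by linarith)
  have hleft : asc a (n + 1) = a * asc (a + 1) n := by
    simp [asc, ascPochhammer_succ_left]
  have hright : asc a (n + 1) = asc a n * (a + n) := by
    simp [asc, ascPochhammer_succ_right]
  rw [div_eq_div_iff hpos.ne' (by positivity)]
  linarith

lemma sum_antidiagonal_pow_div_factorial (x y : ℝ) (n : ℕ) :
    ∑ p ∈ Finset.HasAntidiagonal.antidiagonal n,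
        x ^ p.1 / (p.1 ! : ℝ) * (y ^ p.2 / (p.2 ! : ℝ)) =
      (x + y) ^ n / (n ! : ℝ) := by
  rw [(Commute.all x y).add_pow', Finset.sum_div]
  refine Finset.sum_congr rfl fun p hp => ?_
  rw [Finset.HasAntidiagonal.mem_antidiagonal] at hp
  subst hp
  have h : (((p.1 + p.2).choose p.1 : ℕ) : ℝ) * p.1 ! * p.2 ! = (p.1 + p.2)! := by
    have := Nat.choose_mul_factorial_mul_factorial (Nat.le_add_right p.1 p.2)
    rw [Nat.add_sub_cancel_left] at this
    exact_mod_cast this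
  rw [nsmul_eq_mul, ← h]
  have hc : (((p.1 + p.2).choose p.1 : ℕ) : ℝ) ≠ 0 := by
    exact_mod_cast (Nat.choose_pos (Nat.le_add_right _ _)).ne'
  field_simp

lemma sum_antidiagonal_fst_mul_pow_div_factorial {x y : ℝ} (hs : x + y ≠ 0) (n : ℕ) :
    ∑ p ∈ Finset.HasAntidiagonal.antidiagonal n,
        (p.1 : ℝ) * (x ^ p.1 / (p.1 ! : ℝ) * (y ^ p.2 / (p.2 ! : ℝ))) =
      x / (x + y) * n * ((x + y) ^ n / (n ! : ℝ)) := by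
  cases n with
  | zero => simp
  | succ n =>
    have h : ∀ p : ℕ × ℕ, ((p.1 + 1 : ℕ) : ℝ) *
        (x ^ (p.1 + 1) / ((p.1 + 1)! : ℝ) * (y ^ p.2 / (p.2 ! : ℝ))) =
          x * (x ^ p.1 / (p.1 ! : ℝ) * (y ^ p.2 / (p.2 ! : ℝ))) := fun p => by
      rw [Nat.factorial_succ]
      push_cast
      field_simp
      ring
    rw [Finset.Nat.sum_antidiagonal_succ]
    simp only [h]
    rw [← Finset.mul_sum, sum_antidiagonal_pow_div_factorial, Nat.factorial_succ]
    push_cast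
    field_simp
    ring

lemma summable_poisson_mul_ratio {a b x y : ℝ} (ha : 0 < a) (hb : 0 < b)
    (hx : 0 ≤ x) (hy : 0 ≤ y) :
    Summable fun p : ℕ × ℕ => x ^ p.1 / (p.1 ! : ℝ) * (y ^ p.2 / (p.2 ! : ℝ)) *
      ((a + p.1) / (a + b + p.1 + p.2)) := by
  refine Summable.of_nonneg_of_le (fun p => by positivity) (fun p => ?_)
    ((Real.summable_pow_div_factorial x).mul_of_nonneg (Real.summable_pow_div_factorial y)
      (fun n => by positivity) (fun n => by positivity))
  refine mul_le_of_le_one_right (by positivity) ((div_le_one (by positivity)).2 ?_)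
  have : (0 : ℝ) ≤ p.2 := p.2.cast_nonneg
  linarith

lemma tsum_poisson_mul_ratio {a b x y : ℝ} (ha : 0 < a) (hb : 0 < b)
    (hx : 0 ≤ x) (hy : 0 ≤ y) (hs : 0 < x + y) :
    ∑' j : ℕ, ∑' k : ℕ, x ^ j / (j ! : ℝ) * (y ^ k / (k ! : ℝ)) *
        ((a + j) / (a + b + j + k)) =
      ∑' n : ℕ, (a + x / (x + y) * n) / (a + b + n) * ((x + y) ^ n / (n ! : ℝ)) := by
  have hsum := summable_poisson_mul_ratio ha hb hx hy
  rw [← hsum.tsum_prod, ← Finset.HasAntidiagonal.sigmaAntidiagonalEquivProd.tsum_eq]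
  refine (((Finset.HasAntidiagonal.sigmaAntidiagonalEquivProd.summable_iff).2 hsum).tsum_sigma).trans
    (tsum_congr fun n => ?_)
  rw [tsum_fintype]
  simp only [Function.comp_apply, Finset.HasAntidiagonal.sigmaAntidiagonalEquivProd_apply]
  rw [Finset.sum_coe_sort (Finset.HasAntidiagonal.antidiagonal n) fun p : ℕ × ℕ =>
    x ^ p.1 / (p.1 ! : ℝ) * (y ^ p.2 / (p.2 ! : ℝ)) * ((a + p.1) / (a + b + p.1 + p.2))]
  calc
    _ = ∑ p ∈ Finset.HasAntidiagonal.antidiagonal n,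
        (a / (a + b + n) * (x ^ p.1 / (p.1 ! : ℝ) * (y ^ p.2 / (p.2 ! : ℝ))) +
          1 / (a + b + n) * (p.1 * (x ^ p.1 / (p.1 ! : ℝ) * (y ^ p.2 / (p.2 ! : ℝ))))) := by
      refine Finset.sum_congr rfl fun p hp => ?_
      rw [Finset.HasAntidiagonal.mem_antidiagonal] at hp
      rw [← hp]
      push_cast
      rw [← add_assoc]
      ring
    _ = _ := by
      rw [Finset.sum_add_distrib, ← Finset.mul_sum, ← Finset.mul_sum,
        sum_antidiagonal_pow_div_factorial, sum_antidiagonal_fst_mul_pow_div_factorial hs.ne']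
      ring

lemma hasSum_F11_add_one {a s : ℝ} (ha : 0 < a) (hs : 0 ≤ s) :
    HasSum (fun n : ℕ => a / (a + n) * (s ^ n / (n ! : ℝ))) (F11 a (a + 1) s) := by
  have hsum : Summable fun n : ℕ => a / (a + n) * (s ^ n / (n ! : ℝ)) := by
    refine Summable.of_nonneg_of_le (fun n => by positivity) (fun n => ?_)
      (Real.summable_pow_div_factorial s)
    refine mul_le_of_le_one_left (by positivity) ((div_le_one (by positivity)).2 ?_)
    have : (0 : ℝ) ≤ n := n.cast_nonneg
    linarith
  convert hsum.hasSum using 1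
  simp only [F11, asc_div_asc_add_one ha, mul_div_assoc]

lemma tsum_linear_div_mul_pow_div_factorial {a s : ℝ} (ha : 0 < a) (hs : 0 ≤ s) (c d : ℝ) :
    ∑' n : ℕ, (c + d * n) / (a + n) * (s ^ n / (n ! : ℝ)) =
      c / a * F11 a (a + 1) s + d * (Real.exp s - F11 a (a + 1) s) := by
  have hF := hasSum_F11_add_one ha hs
  have hE : HasSum (fun n : ℕ => s ^ n / (n ! : ℝ)) (Real.exp s) := by
    rw [Real.exp_eq_exp_ℝ]
    exact NormedSpace.expSeries_div_hasSum_exp s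
  rw [← ((hF.mul_left (c / a)).add ((hE.sub hF).mul_left d)).tsum_eq]
  refine tsum_congr fun n => ?_
  have : a + (n : ℝ) ≠ 0 := by positivity
  field_simp
  ring

/-- Alternative expression for the mean of the doubly non-central beta distribution:
`M = (α1/α⁺)[e^{−λ⁺/2} ₁F₁(α⁺; α⁺+1; λ⁺/2)] + (λ1/λ⁺)[1 − e^{−λ⁺/2} ₁F₁(α⁺; α⁺+1; λ⁺/2)]`. -/
theorem dncBeta_mean_alternative (α1 α2 lam1 lam2 : ℝ)
    (hα1 : 0 < α1) (hα2 : 0 < α2) (hl1 : 0 ≤ lam1) (hl2 : 0 ≤ lam2)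
    (hlsum : 0 < lam1 + lam2) :
    (∑' j : ℕ, ∑' k : ℕ,
        (Real.exp (-(lam1 / 2)) * (lam1 / 2) ^ j / (j ! : ℝ)) *
          (Real.exp (-(lam2 / 2)) * (lam2 / 2) ^ k / (k ! : ℝ)) *
          ((α1 + j) / (α1 + α2 + j + k))) =
      (α1 / (α1 + α2)) *
          (Real.exp (-((lam1 + lam2) / 2)) *
            F11 (α1 + α2) (α1 + α2 + 1) ((lam1 + lam2) / 2)) +
        (lam1 / (lam1 + lam2)) *
          (1 - Real.exp (-((lam1 + lam2) / 2)) *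
            F11 (α1 + α2) (α1 + α2 + 1) ((lam1 + lam2) / 2)) := by
  have hs : 0 < lam1 / 2 + lam2 / 2 := by linarith
  have hterm : ∀ j k : ℕ, (Real.exp (-(lam1 / 2)) * (lam1 / 2) ^ j / (j ! : ℝ)) *
      (Real.exp (-(lam2 / 2)) * (lam2 / 2) ^ k / (k ! : ℝ)) *
        ((α1 + j) / (α1 + α2 + j + k)) =
      Real.exp (-((lam1 + lam2) / 2)) * ((lam1 / 2) ^ j / (j ! : ℝ) *
        ((lam2 / 2) ^ k / (k ! : ℝ)) * ((α1 + j) / (α1 + α2 + j + k))) := fun j k => by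
    rw [show -((lam1 + lam2) / 2) = -(lam1 / 2) + -(lam2 / 2) by ring, Real.exp_add]
    ring
  have hratio : lam1 / 2 / (lam1 / 2 + lam2 / 2) = lam1 / (lam1 + lam2) := by
    rw [← add_div, div_div_div_cancel_right₀ two_ne_zero]
  have hexp : Real.exp (-((lam1 + lam2) / 2)) * Real.exp ((lam1 + lam2) / 2) = 1 := by
    rw [← Real.exp_add, neg_add_cancel, Real.exp_zero]
  simp only [hterm, tsum_mul_left]
  rw [tsum_poisson_mul_ratio hα1 hα2 (by positivity) (by positivity) hs,
    tsum_linear_div_mul_pow_div_factorial (add_pos hα1 hα2) hs.le, hratio, ← add_div]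
  linear_combination lam1 / (lam1 + lam2) * hexp
end
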